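/- Let h ∈ ℂ[x_1, …, x_n] be weighted homogeneous of weighted degree m with respect to weights m_1, …, m_n, and suppose its Milnor algebra Q(h) is finite-dimensional over ℂ. Then the Hilbert series of the graded Milnor algebra satisfies the identity of formal power series (∏_{i=1}^n (1 − T^{m_i})) · Σ_{k≥0} dim_ℂ Q(h)_k · T^k = ∏_{i=1}^n (1 − T^{m−m_i}) in ℤ⟦T⟧; equivalently, Σ_{k≥0} dim_ℂ Q(h)_k · T^k = ∏_{i=1}^n (1 − T^{m−m_i})/(1 − T^{m_i}). -/

import Mathlib

open MvPolynomial

/-- The Jacobian ideal of `h`, generated by its partial derivatives. -/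
noncomputable def jacobianIdeal (n : ℕ) (h : MvPolynomial (Fin n) ℂ) :
    Ideal (MvPolynomial (Fin n) ℂ) :=
  Ideal.span (Set.range fun i => MvPolynomial.pderiv i h)

/-- The Milnor algebra `Q(h) = ℂ[x_1,…,x_n]/(∂h/∂x_1,…,∂h/∂x_n)`. -/
noncomputable abbrev milnorAlgebra (n : ℕ) (h : MvPolynomial (Fin n) ℂ) :=
  MvPolynomial (Fin n) ℂ ⧸ jacobianIdeal n h

/-- The weighted-degree-`k` graded piece of the Milnor algebra: the image in `Q(h)` of the
space of weighted homogeneous polynomials of weighted degree `k`. -/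
noncomputable def milnorPiece (n : ℕ) (w : Fin n → ℕ) (h : MvPolynomial (Fin n) ℂ) (k : ℕ) :
    Submodule ℂ (milnorAlgebra n h) :=
  Submodule.map (Ideal.Quotient.mkₐ ℂ (jacobianIdeal n h)).toLinearMap
    (MvPolynomial.weightedHomogeneousSubmodule ℂ w k)

open RingTheory.Sequence IsLocalRing


section loc
variable {R : Type*} [CommRing R] [IsNoetherianRing R] [IsLocalRing R]

lemma supportDim_nonpos_iff (M : Type*) [AddCommGroup M] [Module R M] :
    Module.supportDim R M ≤ 0 ↔ ∀ p ∈ Module.support R M, p.asIdeal = maximalIdeal R := by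
  rw [Module.supportDim, Order.krullDim_nonpos_iff_forall_isMax]
  constructor
  · intro h p hp
    have h1 := h ⟨p, hp⟩
    have hle : p ≤ closedPoint R := IsLocalRing.le_maximalIdeal p.2.ne_top
    have h2 : closedPoint R ∈ Module.support R M := Module.mem_support_mono hle hp
    have := @h1 ⟨closedPoint R, h2⟩ hle
    exact le_antisymm hle this
  · rintro h ⟨p, hp⟩ ⟨q, hq⟩ hpq
    have : p = q := by
      ext1; rw [h p hp, h q hq]
    subst this; exact le_rfl

lemma supportDim_le_add_length {M : Type*} [AddCommGroup M] [Module R M] [Module.Finite R M]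
    (rs : List R) (h : ∀ r ∈ rs, r ∈ maximalIdeal R) :
    Module.supportDim R M ≤
      Module.supportDim R (M ⧸ (Ideal.ofList rs • ⊤ : Submodule R M)) + rs.length := by
  induction rs generalizing M with
  | nil =>
    rw [Ideal.ofList_nil, Submodule.bot_smul]
    simpa using (Module.supportDim_eq_of_equiv (Submodule.quotEquivOfEqBot (⊥ : Submodule R M) rfl)).ge
  | cons x rs ih =>
    rw [Module.supportDim_eq_of_equiv (Submodule.quotOfListConsSMulTopEquivQuotSMulTopInner M x _)]
    refine (Module.supportDim_le_supportDim_quotSMulTop_succ (h x (by simp))).trans ?_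
    have := ih (M := QuotSMulTop x M) (fun r hr => h r (by simp [hr]))
    push_cast [List.length_cons]
    rw [← add_assoc]
    gcongr

lemma isSMulRegular_of_ass {N : Type*} [AddCommGroup N] [Module R N] (c : R)
    (h : ∀ p ∈ associatedPrimes R N, c ∉ p) : IsSMulRegular N c := by
  have := biUnion_associatedPrimes_eq_compl_regular R N
  by_contra hc
  have h2 : c ∈ ({r : R | IsSMulRegular N r} : Set R)ᶜ := hc
  rw [← this] at h2
  simp only [Set.mem_iUnion] at h2
  obtain ⟨p, hp, hcp⟩ := h2
  exact h p hp hcp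

lemma notMem_of_ass {N : Type*} [AddCommGroup N] [Module R N] (c : R)
    (hc : IsSMulRegular N c) (p) (hp : p ∈ associatedPrimes R N) : c ∉ p := by
  have := biUnion_associatedPrimes_eq_compl_regular R N
  intro hcp
  have h2 : c ∈ ({r : R | IsSMulRegular N r} : Set R)ᶜ := by
    rw [← this]; simp only [Set.mem_iUnion]; exact ⟨p, hp, hcp⟩
  exact h2 hc

theorem cm_exchange (n : ℕ) : ∀ {M : Type*} [AddCommGroup M] [Module R M] [Module.Finite R M]
    (as fs : List R), as.length = n → fs.length = n → IsRegular M as →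
    (∀ r ∈ fs, r ∈ maximalIdeal R) →
    (Module.supportDim R (M ⧸ (Ideal.ofList fs • ⊤ : Submodule R M)) ≤ 0) →
    IsWeaklyRegular M fs := by
  induction n with
  | zero =>
    intro M _ _ _ as fs _ hf _ _ _
    rw [List.length_eq_zero_iff] at hf
    subst hf; simp
  | succ n ih =>
    intro M _ _ _ as fs has hfs ha hfm hdim
    obtain ⟨a, as, rfl⟩ := List.exists_of_length_succ _ has
    obtain ⟨f, fs, rfl⟩ := List.exists_of_length_succ _ hfs
    simp only [List.length_cons, add_left_inj] at has hfs
    have hntM : Nontrivial M := ha.nontrivial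
    have hmem : ∀ r ∈ a :: as, r ∈ maximalIdeal R := by
      intro x h6
      refine IsLocalRing.le_maximalIdeal ?_ (Ideal.subset_span (s := {r | r ∈ a :: as}) h6)
      intro h
      apply ha.2
      change ⊤ = Ideal.span {r | r ∈ a :: as} • (⊤ : Submodule R M)
      rw [h, Submodule.top_smul]
    have hp1 : (a :: as).Perm (as ++ [a]) := (List.perm_append_singleton a as).symm
    have ha1 := (IsLocalRing.isRegular_of_perm ha hp1).1
    rw [isWeaklyRegular_append_iff, isWeaklyRegular_singleton_iff] at ha1
    have hdM := Module.supportDim_add_length_eq_supportDim_of_isRegular _ ha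
    have hnt := ha.quot_ofList_smul_nontrivial ⊤
    set N1 := M ⧸ (Ideal.ofList as • ⊤ : Submodule R M) with hN1
    set N2 := M ⧸ (Ideal.ofList fs • ⊤ : Submodule R M) with hN2
    have hfs_m : ∀ r ∈ fs, r ∈ maximalIdeal R := fun r hr => hfm r (by simp [hr])
    have hf_m : f ∈ maximalIdeal R := hfm f (by simp)
    have hdimP : Module.supportDim R (QuotSMulTop f N2) ≤ 0 := by
      rwa [← Module.supportDim_eq_of_equiv
        (Submodule.quotOfListConsSMulTopEquivQuotSMulTopOuter M f fs)]
    have hge : ¬ Module.supportDim R N2 ≤ 0 := by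
      intro h0
      have h1 := supportDim_le_add_length (M := M) fs hfs_m
      have h2 : (0 : WithBot ℕ∞) ≤ Module.supportDim R (M ⧸ (Ideal.ofList (a :: as) • ⊤ : Submodule R M)) := by
        rw [Module.supportDim]
        have := Module.nonempty_support_of_nontrivial (R := R)
          (M := (M ⧸ (Ideal.ofList (a :: as) • ⊤ : Submodule R M)))
        have := this.to_subtype
        exact Order.krullDim_nonneg
      have h3 : ((n + 1 : ℕ) : WithBot ℕ∞) ≤ Module.supportDim R M := by
        rw [← hdM]; simp only [List.length_cons, has]
        exact le_add_of_nonneg_left h2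
      have h4 : Module.supportDim R M ≤ (n : WithBot ℕ∞) := by
        refine h1.trans ?_
        rw [hfs]
        calc _ ≤ (0 : WithBot ℕ∞) + n := by gcongr
          _ = n := by simp
      have := h3.trans h4
      have := Nat.cast_le.mp this
      omega
    have hle : Module.supportDim R N2 ≤ 1 := by
      refine (Module.supportDim_le_supportDim_quotSMulTop_succ hf_m).trans ?_
      calc _ ≤ (0 : WithBot ℕ∞) + 1 := by gcongr
          _ = 1 := by simp
    have hmin : maximalIdeal R ∉ (Module.annihilator R N2).minimalPrimes := by
      intro hm
      apply hge
      rw [supportDim_nonpos_iff]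
      intro p hp
      rw [Module.mem_support_iff_of_finite] at hp
      exact le_antisymm (IsLocalRing.le_maximalIdeal p.2.ne_top)
        (hm.2 ⟨p.2, hp⟩ (IsLocalRing.le_maximalIdeal p.2.ne_top))
    have hass : maximalIdeal R ∉ associatedPrimes R N1 := fun hm =>
      notMem_of_ass a ha1.2 _ hm (hmem a (by simp))
    obtain ⟨c, hcm, hc1, hc2⟩ : ∃ c ∈ maximalIdeal R, (∀ p ∈ associatedPrimes R N1, c ∉ p) ∧
        (∀ p ∈ (Module.annihilator R N2).minimalPrimes, c ∉ p) := by
      by_contra hcon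
      push Not at hcon
      have hfin1 : (associatedPrimes R N1).Finite := associatedPrimes.finite R N1
      have hfin2 := (Module.annihilator R N2).finite_minimalPrimes_of_isNoetherianRing R
      have hfin := hfin1.union hfin2
      have hpr : ∀ p ∈ associatedPrimes R N1 ∪ (Module.annihilator R N2).minimalPrimes, p.IsPrime := by
        rintro p (hp | hp)
        · exact hp.isPrime
        · exact hp.1.1
      have := (Ideal.subset_union_prime (s := hfin.toFinset) (f := id) (I := maximalIdeal R) ⊥ ⊥
        (fun i hi _ _ => hpr i (by simpa using hi))).1 (by
          intro c hc
          simp only [Set.mem_iUnion, Set.Finite.coe_toFinset, id]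
          by_cases h : ∀ p ∈ associatedPrimes R N1, c ∉ p
          · obtain ⟨p, hp, hcp⟩ := hcon c hc h
            exact ⟨p, Or.inr hp, hcp⟩
          · push Not at h
            obtain ⟨p, hp, hcp⟩ := h
            exact ⟨p, Or.inl hp, hcp⟩)
      obtain ⟨p, hp, hmp⟩ := this
      have hp' : p ∈ associatedPrimes R N1 ∪ (Module.annihilator R N2).minimalPrimes := by simpa using hp
      have : p = maximalIdeal R :=
        le_antisymm (IsLocalRing.le_maximalIdeal (hpr p hp').ne_top) hmp
      subst this
      rcases hp' with h | h
      · exact hass h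
      · exact hmin h
    have hc1' : IsWeaklyRegular M (as ++ [c]) := by
      rw [isWeaklyRegular_append_iff, isWeaklyRegular_singleton_iff]
      exact ⟨ha1.1, isSMulRegular_of_ass c hc1⟩
    have hc3 : IsRegular M (as ++ [c]) :=
      IsRegular.of_isWeaklyRegular_of_mem_maximalIdeal _ (by
        intro r hr
        simp only [List.mem_append, List.mem_singleton] at hr
        rcases hr with hr | rfl
        · exact hmem r (by simp [hr])
        · exact hcm) hc1'
    have hc4 := IsLocalRing.isRegular_of_perm hc3 (List.perm_append_singleton c as)
    rw [isRegular_cons_iff] at hc4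
    have hdc : Module.supportDim R (QuotSMulTop c N2) ≤ 0 := by
      have h1 := (Module.supportDim_quotSMulTop_succ_le_of_notMem_minimalPrimes hc2).trans hle
      generalize Module.supportDim R (QuotSMulTop c N2) = x at h1
      induction x with
      | bot => exact bot_le
      | coe x =>
        have h2 : x + 1 ≤ 1 := by exact_mod_cast h1
        have h3 : x ≤ 0 := by
          have : x + 1 ≤ 0 + 1 := by simpa using h2
          exact (ENat.add_le_add_iff_right (by simp)).1 this
        exact_mod_cast h3
    have h5 := ih (M := QuotSMulTop c M) as fs has hfs hc4.2 hfs_m (by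
      rw [← Module.supportDim_eq_of_equiv
        (Submodule.quotOfListConsSMulTopEquivQuotSMulTopInner M c fs),
        Module.supportDim_eq_of_equiv
        (Submodule.quotOfListConsSMulTopEquivQuotSMulTopOuter M c fs)]
      exact hdc)
    have h6 : IsWeaklyRegular M (c :: fs) := IsWeaklyRegular.cons hc4.1 h5
    have h7 := IsLocalRing.isWeaklyRegular_of_perm_of_subset_maximalIdeal h6
      (List.perm_append_singleton c fs).symm (by
        intro r hr
        rcases List.mem_cons.1 hr with rfl | hr
        · exact hcm
        · exact hfs_m r hr)
    rw [isWeaklyRegular_append_iff, isWeaklyRegular_singleton_iff] at h7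
    have h8 : IsSMulRegular N2 f := by
      apply isSMulRegular_of_ass
      intro p hp hfp
      have hpp := hp.isPrime
      have hs : (⟨p, hpp⟩ : PrimeSpectrum R) ∈ Module.support R (QuotSMulTop f N2) := by
        rw [Module.support_quotSMulTop]
        refine ⟨?_, by simpa using hfp⟩
        rw [Module.mem_support_iff_of_finite]
        simpa [Submodule.annihilator_top] using hp.annihilator_le
      have := (supportDim_nonpos_iff _).1 hdimP _ hs
      simp only at this
      subst this
      exact notMem_of_ass c h7.2 _ hp hcm
    have h9 : IsWeaklyRegular M (fs ++ [f]) := by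
      rw [isWeaklyRegular_append_iff, isWeaklyRegular_singleton_iff]
      exact ⟨h7.1, h8⟩
    exact IsLocalRing.isWeaklyRegular_of_perm_of_subset_maximalIdeal h9
      (List.perm_append_singleton f fs) (by
        intro r hr
        simp only [List.mem_append, List.mem_singleton] at hr
        rcases hr with hr | rfl
        · exact hfs_m r hr
        · exact hf_m)
end loc

section graded
variable {n : ℕ}

lemma whc_mul (w : Fin n → ℕ) {f z : MvPolynomial (Fin n) ℂ} {d : ℕ}
    (hf : IsWeightedHomogeneous w f d) (k : ℕ) :
    weightedHomogeneousComponent w k (f * z) =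
      if d ≤ k then f * weightedHomogeneousComponent w (k - d) z else 0 := by
  let := MvPolynomial.weightedGradedAlgebra ℂ w
  have := DirectSum.coe_decompose_mul_of_left_mem (weightedHomogeneousSubmodule ℂ w)
    (a := f) (b := z) (i := d) k hf
  have e : ∀ x i, ((DirectSum.decompose (weightedHomogeneousSubmodule ℂ w) x i :
      weightedHomogeneousSubmodule ℂ w i) : MvPolynomial (Fin n) ℂ) =
      weightedHomogeneousComponent w i x := fun x i => decompose'_apply ℂ w x i
  rwa [e, e] at this

/-- graded ideals, elementary form -/
def GrIdeal (w : Fin n → ℕ) (I : Ideal (MvPolynomial (Fin n) ℂ)) : Prop :=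
  ∀ p ∈ I, ∀ k, weightedHomogeneousComponent w k p ∈ I

lemma grIdeal_ofList (w : Fin n → ℕ) (l : List (MvPolynomial (Fin n) ℂ))
    (h : ∀ f ∈ l, ∃ d, IsWeightedHomogeneous w f d) : GrIdeal w (Ideal.ofList l) := by
  let := MvPolynomial.weightedGradedAlgebra ℂ w
  intro p hp k
  refine weightedHomogeneousComponent_mem_of_mem ℂ w ?_ hp k
  exact Ideal.homogeneous_span _ _ (fun x hx => h x hx)

noncomputable def hpiece (w : Fin n → ℕ) (I : Ideal (MvPolynomial (Fin n) ℂ)) (k : ℕ) :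
    Submodule ℂ (MvPolynomial (Fin n) ℂ ⧸ I) :=
  Submodule.map (Ideal.Quotient.mkₐ ℂ I).toLinearMap
    (MvPolynomial.weightedHomogeneousSubmodule ℂ w k)

lemma mem_hpiece (w : Fin n → ℕ) (I : Ideal (MvPolynomial (Fin n) ℂ)) (k : ℕ) (v) :
    v ∈ hpiece w I k ↔ ∃ y, IsWeightedHomogeneous w y k ∧ Ideal.Quotient.mk I y = v := Iff.rfl

noncomputable def hilb (w : Fin n → ℕ) (I : Ideal (MvPolynomial (Fin n) ℂ)) : PowerSeries ℤ :=
  PowerSeries.mk (fun k => (Module.finrank ℂ (hpiece w I k) : ℤ))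

lemma hpiece_fin (w : Fin n → ℕ) (hw : ∀ i, 0 < w i) (I : Ideal (MvPolynomial (Fin n) ℂ)) (k : ℕ) :
    FiniteDimensional ℂ (hpiece w I k) := by
  have h := weightedHomogeneousSubmodule_fg (R := ℂ) w (fun x => (hw x).ne') k
  exact Module.Finite.iff_fg.2 (h.map _)

lemma finrank_map_inf {V W : Type*} [AddCommGroup V] [Module ℂ V] [AddCommGroup W] [Module ℂ W]
    (φ : V →ₗ[ℂ] W) (A : Submodule ℂ V) [FiniteDimensional ℂ A] :
    Module.finrank ℂ (A.map φ) + Module.finrank ℂ (A ⊓ LinearMap.ker φ : Submodule ℂ V) =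
      Module.finrank ℂ A := by
  have h := LinearMap.finrank_range_add_finrank_ker (φ.domRestrict A)
  rw [← h, LinearMap.range_domRestrict]
  congr 1
  rw [← Submodule.finrank_map_subtype_eq A]
  suffices hs : A ⊓ LinearMap.ker φ = Submodule.map A.subtype (LinearMap.ker (φ.domRestrict A)) by
    rw [hs]
  ext v
  simp only [Submodule.mem_inf, LinearMap.mem_ker, Submodule.mem_map, Submodule.subtype_apply,
    LinearMap.domRestrict_apply, Subtype.exists, exists_and_left, exists_prop, exists_eq_right_right]
  tauto

lemma hilb_step (w : Fin n → ℕ) (hw : ∀ i, 0 < w i) (I : Ideal (MvPolynomial (Fin n) ℂ))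
    (hI : GrIdeal w I) (f : MvPolynomial (Fin n) ℂ) (d : ℕ) (hf : IsWeightedHomogeneous w f d)
    (hreg : ∀ k y, IsWeightedHomogeneous w y k → f * y ∈ I → y ∈ I) :
    hilb w (I ⊔ Ideal.span {f}) = (1 - PowerSeries.X ^ d) * hilb w I := by
  ext k
  have hfin := hpiece_fin w hw I
  let φ : (MvPolynomial (Fin n) ℂ ⧸ I) →ₗ[ℂ] (MvPolynomial (Fin n) ℂ ⧸ I ⊔ Ideal.span {f}) :=
    (Ideal.Quotient.factorₐ ℂ (le_sup_left : I ≤ I ⊔ Ideal.span {f})).toLinearMap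
  have hφ : ∀ y, φ (Ideal.Quotient.mk I y) = Ideal.Quotient.mk _ y := fun y => rfl
  have h1 : (hpiece w I k).map φ = hpiece w (I ⊔ Ideal.span {f}) k := by
    rw [hpiece, ← Submodule.map_comp]; rfl
  have h2 := finrank_map_inf φ (hpiece w I k)
  rw [h1] at h2
  have h3 : Module.finrank ℂ (hpiece w I k ⊓ LinearMap.ker φ : Submodule ℂ _) =
      if d ≤ k then Module.finrank ℂ (hpiece w I (k - d)) else 0 := by
    have key : ∀ v, v ∈ hpiece w I k ⊓ LinearMap.ker φ → ∃ z, Ideal.Quotient.mk I (if d ≤ k then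
        f * weightedHomogeneousComponent w (k - d) z else 0) = v := by
      rintro v ⟨hv, hk⟩
      obtain ⟨y, hy, rfl⟩ := (mem_hpiece ..).1 hv
      rw [SetLike.mem_coe, LinearMap.mem_ker, hφ, Ideal.Quotient.eq_zero_iff_mem] at hk
      obtain ⟨i, hi, g, hg, hig⟩ := Submodule.mem_sup.1 hk
      obtain ⟨z, rfl⟩ := Ideal.mem_span_singleton'.1 hg
      refine ⟨z, ?_⟩
      rw [← whc_mul w hf, Ideal.Quotient.eq]
      have : weightedHomogeneousComponent w k y = y :=
        IsWeightedHomogeneous.weightedHomogeneousComponent_same hy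
      rw [← this, ← hig, map_add, mul_comm z f]
      have := hI i hi k
      convert I.neg_mem this using 1
      ring
    split_ifs with hdk
    · let ψ : (MvPolynomial (Fin n) ℂ ⧸ I) →ₗ[ℂ] (MvPolynomial (Fin n) ℂ ⧸ I) :=
        LinearMap.mulLeft ℂ (Ideal.Quotient.mk I f)
      have h4 : hpiece w I k ⊓ LinearMap.ker φ = (hpiece w I (k - d)).map ψ := by
        apply le_antisymm
        · intro v hv
          obtain ⟨z, rfl⟩ := key v hv
          rw [if_pos hdk]
          refine ⟨Ideal.Quotient.mk I (weightedHomogeneousComponent w (k - d) z), ?_, ?_⟩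
          · exact (mem_hpiece ..).2 ⟨_, weightedHomogeneousComponent_isWeightedHomogeneous _ _, rfl⟩
          · simp [ψ]
        · rintro _ ⟨v, hv, rfl⟩
          obtain ⟨y, hy, rfl⟩ := (mem_hpiece ..).1 hv
          have e : ψ (Ideal.Quotient.mk I y) = Ideal.Quotient.mk I (f * y) := by simp [ψ]
          rw [e]
          refine ⟨(mem_hpiece ..).2 ⟨_, ?_, rfl⟩, ?_⟩
          · have := hf.mul hy
            rwa [Nat.add_sub_cancel' hdk] at this
          · rw [SetLike.mem_coe, LinearMap.mem_ker, hφ, Ideal.Quotient.eq_zero_iff_mem]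
            exact Ideal.mul_mem_right _ _ (Ideal.mem_sup_right (Ideal.mem_span_singleton_self f))
      have h5 := finrank_map_inf ψ (hpiece w I (k - d))
      have h6 : hpiece w I (k - d) ⊓ LinearMap.ker ψ = ⊥ := by
        rw [eq_bot_iff]
        rintro v ⟨hv, hk⟩
        obtain ⟨y, hy, rfl⟩ := (mem_hpiece ..).1 hv
        have e : ψ (Ideal.Quotient.mk I y) = Ideal.Quotient.mk I (f * y) := by simp [ψ]
        rw [SetLike.mem_coe, LinearMap.mem_ker, e, Ideal.Quotient.eq_zero_iff_mem] at hk
        rw [Submodule.mem_bot, Ideal.Quotient.eq_zero_iff_mem]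
        exact hreg _ y hy hk
      rw [h6, finrank_bot, add_zero] at h5
      rw [h4, h5]
    · have : hpiece w I k ⊓ LinearMap.ker φ = ⊥ := by
        rw [eq_bot_iff]
        intro v hv
        obtain ⟨z, rfl⟩ := key v hv
        simp [hdk]
      rw [this, finrank_bot]
  rw [h3] at h2
  rw [sub_mul, one_mul, map_sub, PowerSeries.coeff_X_pow_mul']
  simp only [hilb, PowerSeries.coeff_mk]
  split_ifs at h2 ⊢ <;> omega

/-- The irrelevant maximal ideal. -/
noncomputable abbrev irr (n : ℕ) : Ideal (MvPolynomial (Fin n) ℂ) :=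
  RingHom.ker (constantCoeff : MvPolynomial (Fin n) ℂ →+* ℂ)

instance irr_prime (n : ℕ) : (irr n).IsPrime := RingHom.ker_isPrime _

lemma hreg_of_local (w : Fin n → ℕ) (hw : ∀ i, 0 < w i) (I : Ideal (MvPolynomial (Fin n) ℂ))
    (hI : GrIdeal w I) (f : MvPolynomial (Fin n) ℂ)
    (h : IsSMulRegular (Localization.AtPrime (irr n) ⧸
      (I.map (algebraMap _ (Localization.AtPrime (irr n))) • ⊤ :
        Submodule (Localization.AtPrime (irr n)) (Localization.AtPrime (irr n))))
      (algebraMap _ (Localization.AtPrime (irr n)) f)) :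
    ∀ k y, IsWeightedHomogeneous w y k → f * y ∈ I → y ∈ I := by
  intro k y hy hfy
  have h1 : algebraMap _ (Localization.AtPrime (irr n)) y ∈
      I.map (algebraMap _ (Localization.AtPrime (irr n))) := by
    have h2 := (isSMulRegular_quotient_iff_mem_of_smul_mem _ _).1 h
      (algebraMap _ (Localization.AtPrime (irr n)) y)
    simp only [smul_eq_mul, Ideal.mul_top] at h2
    apply h2
    rw [← map_mul]
    exact Ideal.mem_map_of_mem _ hfy
  rw [IsLocalization.algebraMap_mem_map_algebraMap_iff (irr n).primeCompl] at h1
  obtain ⟨s, hs, hsy⟩ := h1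
  have h3 := hI _ hsy k
  rw [mul_comm, whc_mul w hy, if_pos le_rfl, Nat.sub_self,
    weightedHomogeneousComponent_zero _ (fun i => (hw i).ne')] at h3
  have hs0 : coeff 0 s ≠ 0 := fun h0 => hs (by
    change constantCoeff s = 0
    simpa [constantCoeff_eq] using h0)
  have := I.mul_mem_right (C (coeff 0 s)⁻¹) h3
  rwa [mul_assoc, ← C_mul, mul_inv_cancel₀ hs0, C_1, mul_one] at this

lemma hilb_list (w : Fin n → ℕ) (hw : ∀ i, 0 < w i) (f : Fin n → MvPolynomial (Fin n) ℂ)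
    (d : Fin n → ℕ) (hf : ∀ i, IsWeightedHomogeneous w (f i) (d i)) (l : List (Fin n))
    (hreg : IsWeaklyRegular (Localization.AtPrime (irr n))
      ((l.map f).map (algebraMap _ (Localization.AtPrime (irr n))))) :
    hilb w (Ideal.ofList (l.map f)) =
      (l.map fun i => (1 - PowerSeries.X ^ (d i) : PowerSeries ℤ)).prod * hilb w ⊥ := by
  induction l using List.reverseRecOn with
  | nil => simp
  | append_singleton l i ih =>
    simp only [List.map_append, List.map_cons, List.map_nil] at hreg
    rw [isWeaklyRegular_append_iff, isWeaklyRegular_singleton_iff, ← Ideal.map_ofList] at hreg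
    have hg : GrIdeal w (Ideal.ofList (l.map f)) := grIdeal_ofList w _ (by
      intro g hg
      obtain ⟨i, -, rfl⟩ := List.mem_map.1 hg
      exact ⟨_, hf i⟩)
    rw [List.map_append, List.map_append, Ideal.ofList_append, List.prod_append]
    simp only [List.map_cons, List.map_nil, Ideal.ofList_singleton, List.prod_singleton]
    rw [hilb_step w hw _ hg _ _ (hf i) (hreg_of_local w hw _ hg _ hreg.2), ih hreg.1]
    ring

lemma X_weaklyRegular (l : List (Fin n)) (hl : l.Nodup) :
    IsWeaklyRegular (MvPolynomial (Fin n) ℂ) (l.map (X : Fin n → MvPolynomial (Fin n) ℂ)) := by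
  induction l using List.reverseRecOn with
  | nil => simp
  | append_singleton l i ih =>
    have hl' := List.nodup_append.1 hl
    simp only [List.map_append, List.map_cons, List.map_nil]
    rw [isWeaklyRegular_append_iff, isWeaklyRegular_singleton_iff]
    refine ⟨ih hl'.1, ?_⟩
    rw [isSMulRegular_quotient_iff_mem_of_smul_mem]
    intro y hy
    have e : Ideal.ofList (l.map (X : Fin n → MvPolynomial (Fin n) ℂ)) =
        Ideal.span (X '' {j | j ∈ l}) := by
      rw [Ideal.ofList]; congr 1; ext; simp
    rw [e] at hy ⊢
    simp only [smul_eq_mul, Ideal.mul_top] at hy ⊢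
    rw [mem_ideal_span_X_image] at hy ⊢
    intro e he
    obtain ⟨j, hj, hne⟩ := hy (Finsupp.single i 1 + e) (by
      rw [mem_support_iff] at he ⊢
      rwa [coeff_X_mul])
    refine ⟨j, hj, ?_⟩
    have hij : i ≠ j := by
      rintro rfl
      exact hl'.2.2 i hj i (by simp) rfl
    simpa [Finsupp.single_apply, hij] using hne

lemma local_regular (f : Fin n → MvPolynomial (Fin n) ℂ) (hf : ∀ i, f i ∈ irr n)
    [FiniteDimensional ℂ (MvPolynomial (Fin n) ℂ ⧸ Ideal.span (Set.range f))] :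
    IsWeaklyRegular (Localization.AtPrime (irr n))
      (((List.finRange n).map f).map (algebraMap _ (Localization.AtPrime (irr n)))) := by
  have hX : IsRegular (Localization.AtPrime (irr n))
      (((List.finRange n).map (X : Fin n → MvPolynomial (Fin n) ℂ)).map
        (algebraMap _ (Localization.AtPrime (irr n)))) :=
    IsWeaklyRegular.isRegular_of_isLocalization_of_mem _ (irr n)
      (X_weaklyRegular _ (List.nodup_finRange n)) (by
        intro r hr
        obtain ⟨i, -, rfl⟩ := List.mem_map.1 hr
        simp [RingHom.mem_ker])
  refine cm_exchange n _ _ (by simp) (by simp) hX ?_ ?_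
  · intro r hr
    obtain ⟨g, hg, rfl⟩ := List.mem_map.1 hr
    obtain ⟨i, -, rfl⟩ := List.mem_map.1 hg
    exact (IsLocalization.AtPrime.to_map_mem_maximal_iff _ (irr n) _).2 (hf i)
  · rw [supportDim_nonpos_iff]
    intro p hp
    rw [Module.support_quotient] at hp
    have hp2 : (Ideal.ofList (((List.finRange n).map f).map
      (algebraMap _ (Localization.AtPrime (irr n))))) ≤ p.asIdeal := hp.2
    have hpm : p.asIdeal ≤ maximalIdeal _ := IsLocalRing.le_maximalIdeal p.2.ne_top
    refine le_antisymm hpm ?_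
    rw [← Localization.AtPrime.map_eq_maximalIdeal, Ideal.map_le_iff_le_comap]
    let q := p.asIdeal.comap (algebraMap (MvPolynomial (Fin n) ℂ) (Localization.AtPrime (irr n)))
    have hq : q.IsPrime := Ideal.IsPrime.comap _
    have hJ : Ideal.span (Set.range f) ≤ q := by
      rw [Ideal.span_le]
      rintro _ ⟨i, rfl⟩
      apply hp2
      apply Ideal.subset_span
      simp only [List.map_map, List.mem_map, Set.mem_ofPred_eq]
      exact ⟨i, by simp, rfl⟩
    have hfd : FiniteDimensional ℂ (MvPolynomial (Fin n) ℂ ⧸ q) :=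
      Module.Finite.of_surjective (Ideal.Quotient.factorₐ ℂ hJ).toLinearMap
        (Ideal.Quotient.factor_surjective hJ)
    have hart : IsArtinianRing (MvPolynomial (Fin n) ℂ ⧸ q) :=
      IsArtinianRing.of_finite ℂ _
    have hmax : q.IsMaximal := Ideal.Quotient.maximal_of_isField _
      (IsArtinianRing.isField_of_isDomain _)
    have hle : q ≤ irr n := by
      intro x hx
      have : algebraMap _ (Localization.AtPrime (irr n)) x ∈ maximalIdeal _ := hpm hx
      exact (IsLocalization.AtPrime.to_map_mem_maximal_iff _ (irr n) _).1 this
    exact (hmax.eq_of_le (irr_prime n).ne_top hle).ge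

lemma ofList_finRange (f : Fin n → MvPolynomial (Fin n) ℂ) :
    Ideal.ofList ((List.finRange n).map f) = Ideal.span (Set.range f) := by
  rw [Ideal.ofList]; congr 1; ext; simp

lemma hilb_main (w : Fin n → ℕ) (hw : ∀ i, 0 < w i) (f : Fin n → MvPolynomial (Fin n) ℂ)
    (d : Fin n → ℕ) (hf : ∀ i, IsWeightedHomogeneous w (f i) (d i)) (hfm : ∀ i, f i ∈ irr n)
    [FiniteDimensional ℂ (MvPolynomial (Fin n) ℂ ⧸ Ideal.span (Set.range f))] :
    hilb w (Ideal.span (Set.range f)) =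
      (∏ i, (1 - PowerSeries.X ^ (d i) : PowerSeries ℤ)) * hilb w ⊥ := by
  have := hilb_list w hw f d hf (List.finRange n) (local_regular f hfm)
  rwa [ofList_finRange, ← List.ofFn_eq_map, List.prod_ofFn] at this

lemma irr_le_span_X : irr n ≤ Ideal.span (Set.range (X : Fin n → MvPolynomial (Fin n) ℂ)) := by
  intro p hp
  rw [← Set.image_univ, mem_ideal_span_X_image]
  intro e he
  by_contra hcon
  push Not at hcon
  have : e = 0 := by ext i; simpa using hcon i (Set.mem_univ i)
  subst this
  rw [mem_support_iff] at he
  exact he (by simpa [RingHom.mem_ker, constantCoeff_eq] using hp)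

lemma hilb_X (w : Fin n → ℕ) (hw : ∀ i, 0 < w i) :
    hilb w (Ideal.span (Set.range (X : Fin n → MvPolynomial (Fin n) ℂ))) = 1 := by
  set J := Ideal.span (Set.range (X : Fin n → MvPolynomial (Fin n) ℂ)) with hJ
  have hJ1 : J ≠ ⊤ := by
    have hle : J ≤ irr n := by
      rw [hJ, Ideal.span_le]; rintro _ ⟨i, rfl⟩; simp [RingHom.mem_ker]
    intro h
    exact (irr_prime n).ne_top (top_le_iff.1 (h ▸ hle))
  have : Nontrivial (MvPolynomial (Fin n) ℂ ⧸ J) := Ideal.Quotient.nontrivial_iff.2 hJ1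
  ext k
  rw [hilb, PowerSeries.coeff_mk, PowerSeries.coeff_one]
  split_ifs with hk
  · subst hk
    have hsm : ∀ c : ℂ, (c • (1 : MvPolynomial (Fin n) ℂ ⧸ J)) = Ideal.Quotient.mk J (C c) := by
      intro c
      change Ideal.Quotient.mk J (c • 1) = _
      rw [smul_eq_C_mul, mul_one]
    have : hpiece w J 0 = Submodule.span ℂ {1} := by
      ext v
      rw [mem_hpiece, Submodule.mem_span_singleton]
      constructor
      · rintro ⟨y, hy, rfl⟩
        refine ⟨coeff 0 y, ?_⟩
        have h1 : weightedHomogeneousComponent w 0 y = y :=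
          IsWeightedHomogeneous.weightedHomogeneousComponent_same hy
        rw [weightedHomogeneousComponent_zero _ (fun i => (hw i).ne')] at h1
        rw [← h1]
        rw [coeff_C, if_pos rfl]
        exact hsm _
      · rintro ⟨c, rfl⟩
        refine ⟨C c, isWeightedHomogeneous_C w c, ?_⟩
        exact (hsm c).symm
    rw [this, finrank_span_singleton one_ne_zero]
    rfl
  · have : hpiece w J k = ⊥ := by
      rw [eq_bot_iff]
      intro v hv
      obtain ⟨y, hy, rfl⟩ := (mem_hpiece ..).1 hv
      rw [Submodule.mem_bot, Ideal.Quotient.eq_zero_iff_mem]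
      apply irr_le_span_X
      rw [RingHom.mem_ker, constantCoeff_eq]
      by_contra h0
      have := hy h0
      simp at this
      omega
    rw [this, finrank_bot]
    rfl

lemma fd_X : FiniteDimensional ℂ
    (MvPolynomial (Fin n) ℂ ⧸ Ideal.span (Set.range (X : Fin n → MvPolynomial (Fin n) ℂ))) := by
  refine Module.Finite.of_surjective
    (Algebra.linearMap ℂ _ : ℂ →ₗ[ℂ] (MvPolynomial (Fin n) ℂ ⧸
      Ideal.span (Set.range (X : Fin n → MvPolynomial (Fin n) ℂ)))) ?_
  intro v
  obtain ⟨y, rfl⟩ := Ideal.Quotient.mk_surjective v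
  refine ⟨constantCoeff y, ?_⟩
  change Ideal.Quotient.mk _ (C (constantCoeff y)) = _
  rw [Ideal.Quotient.eq]
  apply irr_le_span_X
  simp [RingHom.mem_ker]

lemma pderiv_wh (w : Fin n → ℕ) (m : ℕ) (h : MvPolynomial (Fin n) ℂ)
    (hwh : IsWeightedHomogeneous w h m) (i : Fin n) :
    IsWeightedHomogeneous w (pderiv i h) (m - w i) := by
  intro e he
  rw [coeff_pderiv] at he
  have := hwh (left_ne_zero_of_mul he)
  rw [map_add, Finsupp.weight_single] at this
  simp at this
  omega
end graded

/-- If `h` is weighted homogeneous of weighted degree `m` for positive weights `w i`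
and its Milnor algebra is finite dimensional, then the Hilbert series of the graded
Milnor algebra satisfies
`(∏ i, (1 - T^(w i))) * ∑_k dim_ℂ Q(h)_k T^k = ∏ i, (1 - T^(m - w i))` in `ℤ⟦T⟧`. -/
theorem milnor_hilbert_series (n : ℕ) (hn : 1 ≤ n)
    (m : ℕ) (hm : 0 < m) (w : Fin n → ℕ) (hw : ∀ i, 0 < w i)
    (h : MvPolynomial (Fin n) ℂ)
    (hwh : MvPolynomial.IsWeightedHomogeneous w h m)
    [FiniteDimensional ℂ (milnorAlgebra n h)] :
    (∏ i, (1 - (PowerSeries.X : PowerSeries ℤ) ^ (w i))) *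
        PowerSeries.mk (fun k => (Module.finrank ℂ (milnorPiece n w h k) : ℤ)) =
      ∏ i, (1 - (PowerSeries.X : PowerSeries ℤ) ^ (m - w i)) := by
  have hmk : PowerSeries.mk (fun k => (Module.finrank ℂ (milnorPiece n w h k) : ℤ)) =
      hilb w (jacobianIdeal n h) := rfl
  rw [hmk]
  have hwf := pderiv_wh w m h hwh
  by_cases hirr : ∀ i, pderiv i h ∈ irr n
  · have hfd : FiniteDimensional ℂ
        (MvPolynomial (Fin n) ℂ ⧸ Ideal.span (Set.range fun i => pderiv i h)) :=
      ‹FiniteDimensional ℂ (milnorAlgebra n h)›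
    have h1 := hilb_main w hw (fun i => pderiv i h) (fun i => m - w i) hwf hirr
    have := fd_X (n := n)
    have h2 := hilb_main w hw X w (fun i => isWeightedHomogeneous_X ℂ w i)
      (fun i => by simp [RingHom.mem_ker])
    rw [hilb_X w hw] at h2
    rw [jacobianIdeal, h1, mul_left_comm, ← h2, mul_one]
  · push Not at hirr
    obtain ⟨i, hi⟩ := hirr
    have hc : coeff 0 (pderiv i h) ≠ 0 := by
      simpa [RingHom.mem_ker, constantCoeff_eq] using hi
    have hz : m - w i = 0 := by
      have := hwf i hc
      simpa using this.symm
    have hJ : jacobianIdeal n h = ⊤ := by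
      have h1 : weightedHomogeneousComponent w 0 (pderiv i h) = pderiv i h :=
        IsWeightedHomogeneous.weightedHomogeneousComponent_same (hz ▸ hwf i)
      rw [weightedHomogeneousComponent_zero _ (fun i => (hw i).ne')] at h1
      refine Ideal.eq_top_of_isUnit_mem _ (x := pderiv i h) (Ideal.subset_span ⟨i, rfl⟩) ?_
      rw [← h1]
      exact (isUnit_iff_ne_zero.2 hc).map C
    have hzero : hilb w (jacobianIdeal n h) = 0 := by
      rw [hJ]
      ext k
      have : Subsingleton (MvPolynomial (Fin n) ℂ ⧸ (⊤ : Ideal (MvPolynomial (Fin n) ℂ))) :=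
        Ideal.Quotient.subsingleton_iff.2 rfl
      simp [hilb, Subsingleton.elim (hpiece w ⊤ k) ⊥]
    rw [hzero, mul_zero]
    symm
    apply Finset.prod_eq_zero (Finset.mem_univ i)
    simp [hz]
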